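/- arXiv:1911.01758 — 2 statements merged into one kernel-verified Lean document; each statement's English description precedes it below -/
import Mathlib

section
/- Suppose in game state (D_k, χ_k, g_k) of the combinatorial Marker-Cutter game there is a directed cycle C with isolated labels a and b. If Marker chooses vertices v, w ∈ V(C) separating the labels a and b, then moves of type (b) and (c) are not legal for restricted Cutter; in particular, restricted Cutter either has to make a move of type (a) or has no legal move. -/
open scoped Classical

namespace MarkerCutter

/-- Labels for the edges of boundary cycles. -/
abbrev Label := ℕ

/-- A boundary cycle is recorded by the list of its edge labels in cyclic order
(an arbitrary linearisation of the cyclic word; the vertices of the cycle are the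
positions between consecutive letters). -/
abbrev Word := List Label

/-- A set of boundary cycles: a multiset of cycles, each a nonempty cyclic word. -/
abbrev Config := Multiset Word

/-- A game state of the combinatorial Marker-Cutter game: a set of labelled boundary
cycles together with the genus counter. -/
abbrev GState := Config × ℕ

/-- The multiset of all labels appearing on edges (with multiplicity). -/
def allLabels (D : Config) : Multiset Label := D.bind fun w => (w : Multiset Label)

/-- A game state is proper if no component is an isolated vertex and every label
appears on at most two edges. -/
def ProperState (γ : GState) : Prop :=
  ([] : Word) ∉ γ.1 ∧ ∀ a : Label, (allLabels γ.1).count a ≤ 2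

/-- The value of a game state: the number of distinct labels appearing on edges. -/
noncomputable def gvalue (γ : GState) : ℕ := (allLabels γ.1).toFinset.card

/-- `w` is a linearisation of the cyclic word `c` read from some other starting vertex. -/
def IsRotationOf (c w : Word) : Prop := ∃ n : ℕ, w = c.rotate n

/-- A label appearing on exactly one edge. -/
def UniquelyAppearing (D : Config) (a : Label) : Prop := (allLabels D).count a = 1

/-- A label appearing on only one cycle. -/
def IsolatedLabel (D : Config) (a : Label) : Prop := Multiset.countP (fun w => a ∈ w) D ≤ 1

/-- A move of Marker: either two (not necessarily distinct) vertices on a common cycle,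
specified by the two segments `P`, `P'` of the cycle between them (with `P = P' = []`
encoding a single dummy vertex chosen twice), or two vertices in different components,
specified by the linearisations `w₁`, `w₂` of the two cycles read from the chosen
vertices (with `[]` encoding a dummy vertex). -/
inductive MChoice : Type
  | same (P P' : Word)
  | diff (w₁ w₂ : Word)

/-- Validity of a Marker move with respect to the current set of boundary cycles. -/
def MValid (D : Config) : MChoice → Prop
  | .same P P' => (P = [] ∧ P' = []) ∨ ∃ c ∈ D, IsRotationOf c (P ++ P')
  | .diff w₁ w₂ =>
      (w₁ = [] ∧ w₂ = []) ∨
      (w₁ = [] ∧ w₂ ≠ [] ∧ ∃ c ∈ D, IsRotationOf c w₂) ∨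
      (w₂ = [] ∧ w₁ ≠ [] ∧ ∃ c ∈ D, IsRotationOf c w₁) ∨
      (w₁ ≠ [] ∧ w₂ ≠ [] ∧ ∃ (D₀ : Config) (c₁ c₂ : Word),
        D = c₁ ::ₘ c₂ ::ₘ D₀ ∧ IsRotationOf c₁ w₁ ∧ IsRotationOf c₂ w₂)

/-- Cutter's legal responses in the (unrestricted) combinatorial Marker-Cutter game:
moves of type (a), (b), (c) for a `same` choice (keeping an arbitrary union `Dkeep` of the
remaining components and an arbitrary `g' ≤ g` for (b), (c)), and the forced move of
type (d) for a `diff` choice.  The two new edges receive a common fresh label `ℓ`. -/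
def CutterResp (γ : GState) (m : MChoice) (γ' : GState) : Prop :=
  ∃ ℓ : Label, ℓ ∉ allLabels γ.1 ∧
    match m with
    | .same P P' =>
        ∃ Drest : Config,
          ((P = [] ∧ P' = [] ∧ Drest = γ.1) ∨
            (∃ c, γ.1 = c ::ₘ Drest ∧ IsRotationOf c (P ++ P'))) ∧
          ((1 ≤ γ.2 ∧ ∃ Dkeep ≤ Drest,
              γ' = ((P ++ [ℓ]) ::ₘ (P' ++ [ℓ]) ::ₘ Dkeep, γ.2 - 1)) ∨
           (∃ Dkeep ≤ Drest, ∃ g' ≤ γ.2, γ' = ((P ++ [ℓ]) ::ₘ Dkeep, g')) ∨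
           (∃ Dkeep ≤ Drest, ∃ g' ≤ γ.2, γ' = ((P' ++ [ℓ]) ::ₘ Dkeep, g')))
    | .diff w₁ w₂ =>
        ∃ Drest : Config,
          ((w₁ = [] ∧ w₂ = [] ∧ Drest = γ.1) ∨
           (w₁ = [] ∧ w₂ ≠ [] ∧ ∃ c, γ.1 = c ::ₘ Drest ∧ IsRotationOf c w₂) ∨
           (w₂ = [] ∧ w₁ ≠ [] ∧ ∃ c, γ.1 = c ::ₘ Drest ∧ IsRotationOf c w₁) ∨
           (w₁ ≠ [] ∧ w₂ ≠ [] ∧ ∃ c₁ c₂, γ.1 = c₁ ::ₘ c₂ ::ₘ Drest ∧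
              IsRotationOf c₁ w₁ ∧ IsRotationOf c₂ w₂)) ∧
          γ' = ((w₁ ++ [ℓ] ++ w₂ ++ [ℓ]) ::ₘ Drest, γ.2)

/-- The result of a move of type (a) by restricted Cutter (who keeps all other
components and decrements the counter). -/
def RMoveA (γ : GState) (P P' : Word) (γ' : GState) : Prop :=
  ∃ ℓ : Label, ℓ ∉ allLabels γ.1 ∧
    ∃ Drest : Config,
      ((P = [] ∧ P' = [] ∧ Drest = γ.1) ∨
        (∃ c, γ.1 = c ::ₘ Drest ∧ IsRotationOf c (P ++ P'))) ∧
      1 ≤ γ.2 ∧ γ' = ((P ++ [ℓ]) ::ₘ (P' ++ [ℓ]) ::ₘ Drest, γ.2 - 1)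

/-- The result of a move of type (b) by restricted Cutter. -/
def RMoveB (γ : GState) (P P' : Word) (γ' : GState) : Prop :=
  ∃ ℓ : Label, ℓ ∉ allLabels γ.1 ∧
    ∃ Drest : Config,
      ((P = [] ∧ P' = [] ∧ Drest = γ.1) ∨
        (∃ c, γ.1 = c ::ₘ Drest ∧ IsRotationOf c (P ++ P'))) ∧
      γ' = ((P ++ [ℓ]) ::ₘ Drest, γ.2)

/-- The result of a move of type (c) by restricted Cutter. -/
def RMoveC (γ : GState) (P P' : Word) (γ' : GState) : Prop :=
  RMoveB γ P' P γ'

/-- Restricted Cutter's responses: as Cutter's, but in moves of type (a), (b), (c) he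
must keep all remaining components and the counter (except for the decrement in (a)). -/
def RCutterResp (γ : GState) (m : MChoice) (γ' : GState) : Prop :=
  match m with
  | .same P P' => RMoveA γ P P' γ' ∨ RMoveB γ P P' γ' ∨ RMoveC γ P P' γ'
  | .diff w₁ w₂ =>
      ∃ ℓ : Label, ℓ ∉ allLabels γ.1 ∧
        ∃ Drest : Config,
          ((w₁ = [] ∧ w₂ = [] ∧ Drest = γ.1) ∨
           (w₁ = [] ∧ w₂ ≠ [] ∧ ∃ c, γ.1 = c ::ₘ Drest ∧ IsRotationOf c w₂) ∨
           (w₂ = [] ∧ w₁ ≠ [] ∧ ∃ c, γ.1 = c ::ₘ Drest ∧ IsRotationOf c w₁) ∨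
           (w₁ ≠ [] ∧ w₂ ≠ [] ∧ ∃ c₁ c₂, γ.1 = c₁ ::ₘ c₂ ::ₘ Drest ∧
              IsRotationOf c₁ w₁ ∧ IsRotationOf c₂ w₂)) ∧
          γ' = ((w₁ ++ [ℓ] ++ w₂ ++ [ℓ]) ::ₘ Drest, γ.2)

/-- Contraction of a single edge of a set of boundary cycles (deleting the component if it
becomes an isolated vertex). -/
def ContractStep (D D' : Config) : Prop :=
  ∃ (D₀ : Config) (u v : Word) (a : Label),
    D = (u ++ a :: v) ::ₘ D₀ ∧
    ((u = [] ∧ v = [] ∧ D' = D₀) ∨ (u ++ v ≠ [] ∧ D' = (u ++ v) ::ₘ D₀))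

/-- `δ` is a reduction of `γ`: the counter does not increase and the boundary cycles of
`δ` are obtained from those of `γ` by a sequence of contractions. -/
def IsReductionOf (δ γ : GState) : Prop :=
  δ.2 ≤ γ.2 ∧ Relation.ReflTransGen ContractStep γ.1 δ.1

/-- Two game states are equivalent if they differ by a bijective relabelling
(and a change of linearisations of the cyclic words). -/
def EquivStates (γ δ : GState) : Prop :=
  γ.2 = δ.2 ∧ ∃ φ : Label → Label, Function.Bijective φ ∧
    Multiset.Rel (fun w w' => IsRotationOf (w.map φ) w') γ.1 δ.1

/-- `γ'` is equivalent to a reduction of `δ`. -/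
def IsEquivReductionOf (γ' δ : GState) : Prop :=
  ∃ ρ : GState, IsReductionOf ρ δ ∧ EquivStates γ' ρ

/-- A response `γ'` of restricted Cutter is legal with respect to a history `hist` of
earlier game states if it is a restricted response which is not equivalent to a
reduction of any earlier game state. -/
def RCLegal (hist : Set GState) (γ : GState) (m : MChoice) (γ' : GState) : Prop :=
  RCutterResp γ m γ' ∧ ∀ δ ∈ hist, ¬ IsEquivReductionOf γ' δ

end MarkerCutter

namespace MarkerCutter

/-- The potential of the edge at position `i` of the path (`cyc = false`) or cycle
(`cyc = true`) `w`: `3/2` if its label appears exactly once in the whole configuration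
(recorded by the multiset `total` of all labels), `3/4` if it is incident on `w` to
another edge with the same label, and `1/2` otherwise. -/
noncomputable def edgePot (total : Multiset Label) (w : Word) (cyc : Bool) (i : ℕ) : ℚ :=
  if total.count (w.getD i 0) = 1 then 3/2
  else if ∃ j < w.length, j ≠ i ∧ w.getD j 0 = w.getD i 0 ∧
      (j = i + 1 ∨ i = j + 1 ∨
        (cyc = true ∧ 2 ≤ w.length ∧ ((i = 0 ∧ j = w.length - 1) ∨ (j = 0 ∧ i = w.length - 1))))
    then 3/4 else 1/2

/-- The potential of a path (`cyc = false`) or cycle (`cyc = true`) `w`. -/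
noncomputable def wordPot (total : Multiset Label) (w : Word) (cyc : Bool) : ℚ :=
  -2 + ∑ i ∈ Finset.range w.length, edgePot total w cyc i

/-- The potential of a game state (with respect to the initial counter `g₀`):
`4(g₀ - g) - 3 v(γ)` plus the sum of the potentials of all components of positive
potential. -/
noncomputable def statePot (g₀ : ℕ) (γ : GState) : ℚ :=
  4 * ((g₀ : ℚ) - (γ.2 : ℚ)) - 3 * (gvalue γ : ℚ) +
    (γ.1.map fun w => max (wordPot (allLabels γ.1) w true) 0).sum

/-- Nesting paths (recorded by their lists of labels): a single edge with a uniquely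
appearing label, or a path with non-isolated labels `(x, y, z)` such that `x` and `z`
also occur on a cycle with labels `(x, t, z, t)`, and `y` also occurs on a cycle
consisting of an edge labelled `y` together with a nesting path. -/
inductive IsNestingPath (D : Config) : Word → Prop
  | single (a : Label) : UniquelyAppearing D a → IsNestingPath D [a]
  | nest (x y z t : Label) (Q : Word) :
      ¬ IsolatedLabel D x → ¬ IsolatedLabel D y → ¬ IsolatedLabel D z →
      (∃ c ∈ D, IsRotationOf c [x, t, z, t]) →
      (∃ c ∈ D, IsRotationOf c (y :: Q)) →
      IsNestingPath D Q →
      IsNestingPath D [x, y, z]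

/-- A strategy for Marker: a move for every finite history of game states. -/
abbrev MStrategy := (n : ℕ) → (Fin (n + 1) → GState) → MChoice

/-- One round against (unrestricted) Cutter: Marker's choice is valid and Cutter
responds legally (the history is irrelevant). -/
def URespond (_hist : Set GState) (γ : GState) (m : MChoice) (γ' : GState) : Prop :=
  MValid γ.1 m ∧ CutterResp γ m γ'

/-- One round against restricted Cutter: Marker's choice is valid and restricted Cutter
responds with a legal restricted move with respect to the history. -/
def RRespond (hist : Set GState) (γ : GState) (m : MChoice) (γ' : GState) : Prop :=
  MValid γ.1 m ∧ RCLegal hist γ m γ'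

/-- The set of game states occurring in the play up to time `k`. -/
def histSet (play : ℕ → GState) (k : ℕ) : Set GState := {δ | ∃ j ≤ k, play j = δ}

/-- Marker's strategy `σ` limits the value of every game state to `t` in the game with
initial counter `g₀` against a Cutter with response relation `Resp`: along every play
consistent with `σ`, Marker's prescribed choice is always valid and the value of every
game state reached is at most `t`. -/
def MarkerLimits (Resp : Set GState → GState → MChoice → GState → Prop)
    (σ : MStrategy) (g₀ t : ℕ) : Prop :=
  ∀ (n : ℕ) (play : ℕ → GState), play 0 = (0, g₀) →
    (∀ k < n, Resp (histSet play k) (play k)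
      (σ k fun j => play ↑j) (play (k + 1))) →
    MValid (play n).1 (σ n fun j => play ↑j) ∧ gvalue (play n) ≤ t

/-- A strategy for Cutter: a response for every finite history of game states and
valid Marker move. -/
abbrev CStrategy := (n : ℕ) → (Fin (n + 1) → GState) → MChoice → GState

/-- A play consistent with a strategy `τ` of restricted Cutter: at every turn Marker
makes a valid move; if a legal restricted response exists Cutter answers according to
`τ`, and otherwise the game has ended (the state is repeated forever). -/
def RConsistentPlay (τ : CStrategy) (g₀ : ℕ) (play : ℕ → GState) (mk : ℕ → MChoice) : Prop :=
  play 0 = (0, g₀) ∧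
  ∀ k, MValid (play k).1 (mk k) ∧
    ((∃ γ', RRespond (histSet play k) (play k) (mk k) γ') →
      play (k + 1) = τ k (fun j => play ↑j) (mk k)) ∧
    ((¬ ∃ γ', RRespond (histSet play k) (play k) (mk k) γ') → play (k + 1) = play k)

end MarkerCutter

namespace MarkerCutter

/-- A cycle contracts to any nonempty cycle obtained by deleting some of its edges. -/
theorem contract_sublist (D : Config) {s m : Word} (h : s.Sublist m) :
    ∀ u : Word, u ++ s ≠ [] →
      Relation.ReflTransGen ContractStep ((u ++ m) ::ₘ D) ((u ++ s) ::ₘ D) := by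
  induction h with
  | slnil => exact fun _ _ => Relation.ReflTransGen.refl
  | @cons l m x h ih =>
    intro u hu
    refine Relation.ReflTransGen.head ?_ (ih u hu)
    refine ⟨D, u, m, x, rfl, Or.inr ⟨fun hum => hu ?_, rfl⟩⟩
    obtain ⟨rfl, rfl⟩ := List.append_eq_nil_iff.mp hum
    simpa using h
  | @cons_cons l m x h ih =>
    intro u _
    simpa using ih (u ++ [x]) (by simp)

/-- Sublists can be carried along rotations, up to rotation. -/
theorem exists_isRotated_sublist {s l m : Word} (h : s.Sublist l) (hlm : l ~r m) :
    ∃ t, s ~r t ∧ t.Sublist m := by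
  obtain ⟨n, hn, rfl⟩ := List.isRotated_iff_mod.mp hlm
  rw [← List.take_append_drop n l] at h
  obtain ⟨s₁, s₂, rfl, h₁, h₂⟩ := List.sublist_append_iff.mp h
  refine ⟨s₂ ++ s₁, List.isRotated_append, ?_⟩
  rw [List.rotate_eq_drop_append_take hn]
  exact h₂.append h₁

theorem isRotationOf_iff_isRotated {c w : Word} : IsRotationOf c w ↔ c ~r w := by
  simp only [IsRotationOf, List.IsRotated, eq_comm]

/-- If the discarded segment `P'` carries an isolated label not occurring on `P`, then the
result of a move of type (b) is equivalent to a reduction of the current game state. -/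
theorem RMoveB.isEquivReductionOf {γ γ' : GState} {P P' : Word} (h : RMoveB γ P P' γ')
    {x : Label} (hx : IsolatedLabel γ.1 x) (hxP' : x ∈ P') (hxP : x ∉ P) :
    IsEquivReductionOf γ' γ := by
  obtain ⟨ℓ, hℓ, D, hD | ⟨c, hγ, hc⟩, rfl⟩ := h
  · simp [hD.2.1] at hxP'
  rw [isRotationOf_iff_isRotated] at hc
  have hxc : x ∈ c := hc.mem_iff.mpr (List.mem_append_right _ hxP')
  have hxD : ∀ w ∈ D, x ∉ w := by
    rw [IsolatedLabel, hγ, Multiset.countP_cons_of_pos (p := fun w => x ∈ w) _ hxc] at hx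
    exact Multiset.countP_eq_zero.mp (by omega)
  have hℓc : ℓ ∉ c := fun hmem => hℓ (by simp [allLabels, hγ, hmem])
  have hℓD : ∀ w ∈ D, ℓ ∉ w := fun w hw hmem =>
    hℓ (Multiset.mem_bind.mpr ⟨w, by simp [hγ, hw], by simpa using hmem⟩)
  have hℓP : ℓ ∉ P := fun hmem => hℓc (hc.mem_iff.mpr (List.mem_append_left _ hmem))
  have hfix : ∀ w : Word, x ∉ w → ℓ ∉ w → w.map (Equiv.swap ℓ x) = w := by
    intro w h₁ h₂
    refine (List.map_congr_left (g := id) fun y hy => ?_).trans (List.map_id _)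
    exact Equiv.swap_apply_of_ne_of_ne (ne_of_mem_of_not_mem hy h₂)
      (ne_of_mem_of_not_mem hy h₁)
  have hsub : (P ++ [x]).Sublist (P ++ P') :=
    (List.singleton_sublist.mpr hxP').append_left P
  obtain ⟨t, ht, htc⟩ := exists_isRotated_sublist hsub hc.symm
  have ht_ne : t ≠ [] := by
    rintro rfl
    simpa using ht.perm.length_eq
  refine ⟨(t ::ₘ D, γ.2), ⟨le_rfl, ?_⟩, rfl, Equiv.swap ℓ x, Equiv.bijective _, ?_⟩
  · rw [hγ]
    exact contract_sublist D htc [] ht_ne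
  · refine Multiset.Rel.cons ?_ (Multiset.rel_refl_of_refl_on fun w hw => ?_)
    · rw [isRotationOf_iff_isRotated, List.map_append, hfix P hxP hℓP]
      simpa using ht
    · rw [hfix w (hxD w hw) (hℓD w hw), isRotationOf_iff_isRotated]

theorem stmt14 (hist : Set GState) (γ : GState) (hγ : γ ∈ hist) (hproper : ProperState γ)
    (D₀ : Config) (c : Word) (a b : Label) (hD : γ.1 = c ::ₘ D₀)
    (hisoa : IsolatedLabel γ.1 a) (hisob : IsolatedLabel γ.1 b)
    (ha : a ∈ c) (hb : b ∈ c)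
    (P P' : Word) (hsplit : IsRotationOf c (P ++ P'))
    (hsep : (a ∈ P ∧ a ∉ P' ∧ b ∈ P' ∧ b ∉ P) ∨ (a ∈ P' ∧ a ∉ P ∧ b ∈ P ∧ b ∉ P')) :
    (∀ γ', RMoveB γ P P' γ' → ¬ RCLegal hist γ (MChoice.same P P') γ') ∧
    (∀ γ', RMoveC γ P P' γ' → ¬ RCLegal hist γ (MChoice.same P P') γ') ∧
    (∀ γ', RCLegal hist γ (MChoice.same P P') γ' → RMoveA γ P P' γ') := by
  have hB : ∀ γ', RMoveB γ P P' γ' → IsEquivReductionOf γ' γ := by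
    intro γ' h
    rcases hsep with ⟨-, -, h₁, h₂⟩ | ⟨h₁, h₂, -, -⟩
    · exact h.isEquivReductionOf hisob h₁ h₂
    · exact h.isEquivReductionOf hisoa h₁ h₂
  have hC : ∀ γ', RMoveC γ P P' γ' → IsEquivReductionOf γ' γ := by
    intro γ' h
    rcases hsep with ⟨h₁, h₂, -, -⟩ | ⟨-, -, h₁, h₂⟩
    · exact RMoveB.isEquivReductionOf h hisoa h₁ h₂
    · exact RMoveB.isEquivReductionOf h hisob h₁ h₂
  refine ⟨fun γ' h hl => hl.2 γ hγ (hB γ' h), fun γ' h hl => hl.2 γ hγ (hC γ' h), ?_⟩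
  rintro γ' ⟨h | h | h, hl⟩
  · exact h
  · exact absurd (hB γ' h) (hl γ hγ)
  · exact absurd (hC γ' h) (hl γ hγ)

end MarkerCutter
end

section
/- For any game state γ of the combinatorial Marker-Cutter game and any move of Marker, if restricted Cutter has a legal move in response, then the resulting game state γ' satisfies v(γ') = v(γ) + 1. -/
open scoped Classical

namespace MarkerCutter

lemma mem_allLabels_cons {a : Label} {w : Word} {D : Config} :
    a ∈ allLabels (w ::ₘ D) ↔ a ∈ w ∨ a ∈ allLabels D := by
  simp [allLabels]

lemma gvalue_eq_succ_of_mem_iff {γ γ' : GState} {ℓ : Label} (hℓ : ℓ ∉ allLabels γ.1)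
    (h : ∀ a, a ∈ allLabels γ'.1 ↔ a = ℓ ∨ a ∈ allLabels γ.1) :
    gvalue γ' = gvalue γ + 1 := by
  have hset : (allLabels γ'.1).toFinset = insert ℓ (allLabels γ.1).toFinset := by
    ext a
    simp [h]
  rw [gvalue, hset, Finset.card_insert_of_notMem (by simpa using hℓ), gvalue]

lemma IsRotationOf.mem_iff {c w : Word} (h : IsRotationOf c w) {a : Label} :
    a ∈ w ↔ a ∈ c := by
  obtain ⟨n, rfl⟩ := h
  exact List.mem_rotate

/-- Replacing a cycle by a nonempty subword is a sequence of contractions. -/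
lemma reflTransGen_contractStep_of_sublist {w' w : Word} (h : w'.Sublist w) (hne : w' ≠ [])
    (D : Config) : Relation.ReflTransGen ContractStep (w ::ₘ D) (w' ::ₘ D) := by
  suffices H : ∀ p : Word, Relation.ReflTransGen ContractStep
      ((p ++ w) ::ₘ D) ((p ++ w') ::ₘ D) ∨ p ++ w' = [] by
    simpa [hne] using H []
  clear hne
  induction h with
  | slnil => exact fun p => Or.inl .refl
  | @cons l₁ l₂ a _ ih =>
    intro p
    by_cases hp : p ++ l₁ = []
    · exact Or.inr hp
    refine Or.inl (Relation.ReflTransGen.head ?_ ((ih p).resolve_right hp))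
    refine ⟨D, p, l₂, a, rfl, Or.inr ⟨fun h0 => hp ?_, rfl⟩⟩
    simp_all
  | @cons_cons l₁ l₂ a _ ih =>
    intro p
    simpa using ih (p ++ [a])

/-- A subword of a rotation of `c` is a rotation of a subword of `c`. -/
lemma exists_sublist_isRotationOf {c w s : Word} (h : IsRotationOf c w) (hs : s.Sublist w) :
    ∃ s', s'.Sublist c ∧ IsRotationOf s s' := by
  obtain ⟨n, rfl⟩ := h
  rw [List.rotate_eq_drop_append_take_mod, List.sublist_append_iff] at hs
  obtain ⟨s₁, s₂, rfl, h₁, h₂⟩ := hs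
  refine ⟨s₂ ++ s₁, ?_, s₁.length, by simp⟩
  simpa using h₂.append h₁

/-- If the discarded segment `P'` carries a label occurring nowhere else, then the result of
a move of type (b) is equivalent to a reduction of the current state. -/
lemma isEquivReductionOf_of_label_lost {c P P' : Word} {D : Config} {g : ℕ} {ℓ x : Label}
    (hc : IsRotationOf c (P ++ P')) (hℓ : ℓ ∉ allLabels (c ::ₘ D))
    (hx : x ∈ P') (hxP : x ∉ P) (hxD : x ∉ allLabels D) :
    IsEquivReductionOf ((P ++ [ℓ]) ::ₘ D, g) (c ::ₘ D, g) := by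
  have hsub : (P ++ [x]).Sublist (P ++ P') := (List.singleton_sublist.2 hx).append_left P
  obtain ⟨s, hs, hrot⟩ := exists_sublist_isRotationOf hc hsub
  have hne : s ≠ [] := List.ne_nil_of_mem (hrot.mem_iff.2 (by simp : x ∈ P ++ [x]))
  rw [mem_allLabels_cons, not_or] at hℓ
  have hℓP : ℓ ∉ P := fun h => hℓ.1 (hc.mem_iff.1 (by simp [h]))
  have hfix : ∀ w : Word, ℓ ∉ w → x ∉ w → w.map (Equiv.swap ℓ x) = w := fun w h₁ h₂ => by
    refine (List.map_congr_left fun a ha => ?_).trans w.map_id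
    exact Equiv.swap_apply_of_ne_of_ne (fun h => h₁ (h ▸ ha)) (fun h => h₂ (h ▸ ha))
  refine ⟨(s ::ₘ D, g), ⟨le_rfl, reflTransGen_contractStep_of_sublist hs hne D⟩, rfl,
    Equiv.swap ℓ x, Equiv.bijective _, Multiset.Rel.cons ?_ ?_⟩
  · simpa [hfix P hℓP hxP] using hrot
  · refine Multiset.rel_refl_of_refl_on fun w hw => ⟨0, ?_⟩
    rw [List.rotate_zero, hfix w]
    · exact fun h => hℓ.2 (Multiset.mem_bind.2 ⟨w, hw, h⟩)
    · exact fun h => hxD (Multiset.mem_bind.2 ⟨w, hw, h⟩)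

lemma gvalue_of_rMoveA {γ γ' : GState} {P P' : Word} (h : RMoveA γ P P' γ') :
    gvalue γ' = gvalue γ + 1 := by
  obtain ⟨ℓ, hℓ, D, hD, -, rfl⟩ := h
  refine gvalue_eq_succ_of_mem_iff hℓ fun a => ?_
  rcases hD with ⟨rfl, rfl, rfl⟩ | ⟨c, hc, hrot⟩
  · simp [mem_allLabels_cons]
  · simp only [hc, mem_allLabels_cons, ← hrot.mem_iff, List.mem_append, List.mem_singleton]
    tauto

lemma gvalue_of_rMoveB {γ γ' : GState} {P P' : Word} (h : RMoveB γ P P' γ')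
    (hred : ¬ IsEquivReductionOf γ' γ) : gvalue γ' = gvalue γ + 1 := by
  obtain ⟨ℓ, hℓ, D, hD, rfl⟩ := h
  refine gvalue_eq_succ_of_mem_iff hℓ fun a => ?_
  rcases hD with ⟨rfl, rfl, rfl⟩ | ⟨c, hc, hrot⟩
  · simp [mem_allLabels_cons]
  · obtain ⟨E, g⟩ := γ
    obtain rfl : E = c ::ₘ D := hc
    have hkeep : a ∈ P' → a ∈ P ∨ a ∈ allLabels D := fun ha => by
      by_contra! hlost
      exact hred (isEquivReductionOf_of_label_lost hrot hℓ ha hlost.1 hlost.2)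
    simp only [mem_allLabels_cons, ← hrot.mem_iff, List.mem_append, List.mem_singleton]
    tauto

theorem stmt15 (hist : Set GState) (γ : GState) (hγ : γ ∈ hist)
    (hproper : ProperState γ) (m : MChoice) (hm : MValid γ.1 m)
    (γ' : GState) (hlegal : RCLegal hist γ m γ') :
    gvalue γ' = gvalue γ + 1 := by
  obtain ⟨hresp, hred⟩ := hlegal
  cases m with
  | same P P' =>
    rcases hresp with h | h | h
    · exact gvalue_of_rMoveA h
    · exact gvalue_of_rMoveB h (hred γ hγ)
    · exact gvalue_of_rMoveB (P := P') (P' := P) h (hred γ hγ)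
  | diff w₁ w₂ =>
    obtain ⟨ℓ, hℓ, D, hD, rfl⟩ := hresp
    refine gvalue_eq_succ_of_mem_iff hℓ fun a => ?_
    rcases hD with ⟨rfl, rfl, rfl⟩ | ⟨rfl, -, c, hc, hrot⟩ | ⟨rfl, -, c, hc, hrot⟩ |
      ⟨-, -, c₁, c₂, hc, hrot₁, hrot₂⟩
    · simp [mem_allLabels_cons]
    · simp only [hc, mem_allLabels_cons, ← hrot.mem_iff, List.mem_append, List.mem_singleton,
        List.not_mem_nil]
      tauto
    · simp only [hc, mem_allLabels_cons, ← hrot.mem_iff, List.mem_append, List.mem_singleton,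
        List.not_mem_nil]
      tauto
    · simp only [hc, mem_allLabels_cons, ← hrot₁.mem_iff, ← hrot₂.mem_iff, List.mem_append,
        List.mem_singleton]
      tauto

end MarkerCutter
end
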